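/- Let C be an isomorphism-closed class of separated uniform spaces. Then the following are equivalent: (1) C is closed under products, closed under closed subspaces, and closed under dense images; (2) C is one of the following: the class of all separated uniform spaces with at most one point; the class of all compact separated uniform spaces; the class of all separated uniform spaces of covering character at most λ₀, for some infinite cardinal λ₀; the class of all separated uniform spaces. -/

import Mathlib

universe u

open Uniformity

/-- A class of uniform spaces (in a fixed universe `u`). -/
abbrev UnifClass := ∀ X : Type u, UniformSpace X → Prop

/-- A uniform space is separated if the intersection of all entourages is the diagonal. -/
def IsSeparatedUnif (X : Type u) (uX : UniformSpace X) : Prop :=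
  ∀ x y : X, (∀ V ∈ @uniformity X uX, (x, y) ∈ V) → x = y

/-- `C` is closed under uniform isomorphisms. -/
def UnifClass.IsoClosed (C : UnifClass.{u}) : Prop :=
  ∀ (X Y : Type u) (uX : UniformSpace X) (uY : UniformSpace Y),
    C X uX → Nonempty (@UniformEquiv X Y uX uY) → C Y uY

/-- `C` is closed under arbitrary products (with the product uniformity). -/
def UnifClass.ClosedUnderProducts (C : UnifClass.{u}) : Prop :=
  ∀ (ι : Type u) (X : ι → Type u) (t : ∀ i, UniformSpace (X i)),
    (∀ i, C (X i) (t i)) → C (∀ i, X i) (@Pi.uniformSpace ι X t)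

/-- `C` is closed under closed subspaces (uniform embeddings with closed range). -/
def UnifClass.ClosedUnderClosedSubspaces (C : UnifClass.{u}) : Prop :=
  ∀ (X Y : Type u) (uX : UniformSpace X) (uY : UniformSpace Y),
    C X uX →
    (∃ f : Y → X, @IsUniformEmbedding Y X uY uX f ∧
      @IsClosed X uX.toTopologicalSpace (Set.range f)) → C Y uY

/-- `C` is closed under dense images: images of uniformly continuous maps
with dense range, landing in separated uniform spaces. -/
def UnifClass.ClosedUnderDenseImages (C : UnifClass.{u}) : Prop :=
  ∀ (X Y : Type u) (uX : UniformSpace X) (uY : UniformSpace Y),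
    C X uX → IsSeparatedUnif Y uY →
    (∃ f : X → Y, @UniformContinuous X Y uX uY f ∧
      @DenseRange Y uY.toTopologicalSpace X f) → C Y uY

/-- A subset of a uniform space is uniformly discrete if some entourage separates
all pairs of its distinct points. -/
def IsUniformlyDiscrete {X : Type u} (uX : UniformSpace X) (S : Set X) : Prop :=
  ∃ V ∈ @uniformity X uX, ∀ x ∈ S, ∀ y ∈ S, x ≠ y → (x, y) ∉ V

/-- A uniform space has covering character at most `lam` if every uniformly discrete
subset has cardinality strictly less than `lam`. -/
def CovCharLE (X : Type u) (uX : UniformSpace X) (lam : Cardinal.{u}) : Prop :=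
  ∀ S : Set X, IsUniformlyDiscrete uX S → Cardinal.mk S < lam

open Filter Set Topology UniformSpace

theorem isSeparatedUnif_iff_t0Space (X : Type u) [uX : UniformSpace X] :
    IsSeparatedUnif X uX ↔ T0Space X :=
  t0Space_iff_uniformity.symm

section CoveringCharacter

/-- Every entourage admits a uniformly discrete set of centers of balls covering the space. -/
theorem exists_isUniformlyDiscrete_cover {X : Type u} [uX : UniformSpace X]
    {V : Set (X × X)} (hV : V ∈ 𝓤 X) :
    ∃ S : Set X, IsUniformlyDiscrete uX S ∧ ∀ x, ∃ y ∈ S, (x, y) ∈ V := by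
  obtain ⟨W, hW, hWs, hWV⟩ := comp_symm_mem_uniformity_sets hV
  have hWr : SetRel.IsRefl W := ⟨fun x ↦ refl_mem_uniformity hW⟩
  obtain ⟨N, hN⟩ := zorn_subset {N : Set X | N ⊆ univ ∧ SetRel.IsSeparated W N} (by
    intro c hc hchain
    refine ⟨⋃₀ c, ⟨subset_univ _, ?_⟩, fun s hs ↦ subset_sUnion_of_mem hs⟩
    exact (pairwise_sUnion hchain.directedOn).2 fun s hs ↦ (hc hs).2)
  have hcov := SetRel.IsCover.of_maximal_isSeparated hN
  refine ⟨N, ⟨W, hW, fun x hx y hy hxy ↦ hN.prop.2 hx hy hxy⟩, fun x ↦ ?_⟩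
  obtain ⟨y, hy, hxy⟩ := hcov (mem_univ x)
  exact ⟨y, hy, hWV ⟨x, refl_mem_uniformity hW, hxy⟩⟩

theorem covCharLE_iff_cover {X : Type u} [uX : UniformSpace X] {c : Cardinal.{u}} :
    CovCharLE X uX c ↔
      ∀ V ∈ 𝓤 X, ∃ t : Set X, Cardinal.mk t < c ∧ ∀ x, ∃ y ∈ t, (x, y) ∈ V := by
  constructor
  · intro h V hV
    obtain ⟨S, hS, hcov⟩ := exists_isUniformlyDiscrete_cover hV
    exact ⟨S, h S hS, hcov⟩
  · rintro h S ⟨V, hV, hS⟩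
    obtain ⟨W, hW, hWs, hWV⟩ := comp_symm_mem_uniformity_sets hV
    obtain ⟨t, ht, hcov⟩ := h W hW
    choose g hgt hg using hcov
    refine lt_of_le_of_lt (Cardinal.mk_le_of_injective
      (f := fun x : S ↦ (⟨g x, hgt x⟩ : t)) fun x y hxy ↦ ?_) ht
    by_contra hne
    refine hS x x.2 y y.2 (fun h ↦ hne (Subtype.ext h)) (hWV ⟨g x, hg x, ?_⟩)
    rw [show g x = g y from congrArg Subtype.val hxy]
    exact hWs.symm _ _ (hg y)

theorem totallyBounded_univ_iff_covCharLE {X : Type u} [uX : UniformSpace X] :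
    TotallyBounded (univ : Set X) ↔ CovCharLE X uX Cardinal.aleph0 := by
  simp [covCharLE_iff_cover, TotallyBounded, eq_univ_iff_forall]

theorem CovCharLE.pi {ι : Type u} {X : ι → Type u} [t : ∀ i, UniformSpace (X i)]
    {c : Cardinal.{u}} (hc : Cardinal.aleph0 ≤ c) (h : ∀ i, CovCharLE (X i) (t i) c) :
    CovCharLE (∀ i, X i) (Pi.uniformSpace X) c := by
  rintro S ⟨V, hV, hS⟩
  rw [Pi.uniformity, mem_iInf] at hV
  obtain ⟨I, hI, U, hU, rfl⟩ := hV
  have := hI.fintype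
  have hex : ∀ i : I, ∃ W ∈ 𝓤 (X i), SetRel.IsSymm W ∧
      ∀ x y : ∀ i, X i, (x i, y i) ∈ SetRel.comp W W → (x, y) ∈ U i := by
    intro i
    obtain ⟨V, hV, hVU⟩ := hU i
    obtain ⟨W, hW, hWs, hWV⟩ := comp_symm_mem_uniformity_sets hV
    exact ⟨W, hW, hWs, fun x y hxy ↦ hVU (hWV hxy)⟩
  choose W hW hWs hWU using hex
  choose t ht hcov using fun i : I ↦ covCharLE_iff_cover.1 (h i) (W i) (hW i)
  choose g hgt hg using hcov
  have hinj : Function.Injective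
      (fun (x : S) (i : I) ↦ (⟨g i (x.1 i), hgt i (x.1 i)⟩ : t i)) := by
    intro x y hxy
    by_contra hne
    refine hS x x.2 y y.2 (fun h ↦ hne (Subtype.ext h)) (mem_iInter.2 fun i ↦
      hWU i _ _ ⟨g i (x.1 i), hg i _, ?_⟩)
    rw [show g i (x.1 i) = g i (y.1 i) from congrArg Subtype.val (congrFun hxy i)]
    exact (hWs i).symm _ _ (hg i _)
  refine (Cardinal.mk_le_of_injective hinj).trans_lt ?_
  rw [Cardinal.mk_pi, Cardinal.prod_eq_of_fintype, Cardinal.lift_id]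
  exact Finset.prod_induction _ (· < c) (fun a b ha hb ↦ Cardinal.mul_lt_of_lt hc ha hb)
    (Cardinal.one_lt_aleph0.trans_le hc) fun i _ ↦ ht i

theorem CovCharLE.of_isUniformEmbedding {X Y : Type u} [uX : UniformSpace X] [uY : UniformSpace Y]
    {c : Cardinal.{u}} (h : CovCharLE X uX c) {f : Y → X} (hf : IsUniformEmbedding f) :
    CovCharLE Y uY c := by
  rintro S ⟨V, hV, hS⟩
  rw [← hf.comap_uniformity] at hV
  obtain ⟨W, hW, hWV⟩ := hV
  rw [← Cardinal.mk_image_eq hf.injective]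
  refine h _ ⟨W, hW, ?_⟩
  rintro _ ⟨x, hx, rfl⟩ _ ⟨y, hy, rfl⟩ hne hxy
  exact hS x hx y hy (ne_of_apply_ne f hne) (hWV hxy)

theorem CovCharLE.of_denseRange {X Y : Type u} [uX : UniformSpace X] [uY : UniformSpace Y]
    {c : Cardinal.{u}} (h : CovCharLE X uX c) {f : X → Y} (hf : UniformContinuous f)
    (hd : DenseRange f) : CovCharLE Y uY c := by
  rw [covCharLE_iff_cover] at h ⊢
  intro V hV
  obtain ⟨W, hW, hWV⟩ := comp_mem_uniformity_sets hV
  obtain ⟨t, ht, hcov⟩ := h _ (hf hW)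
  refine ⟨f '' t, Cardinal.mk_image_le.trans_lt ht, fun y ↦ ?_⟩
  obtain ⟨x, hx⟩ := hd.exists_mem_open isOpen_interior
    ⟨y, mem_interior_iff_mem_nhds.2 (mem_nhds_left y hW)⟩
  obtain ⟨z, hz, hxz⟩ := hcov x
  exact ⟨f z, mem_image_of_mem f hz, hWV ⟨f x, interior_subset (s := {z | (y, z) ∈ W}) hx, hxz⟩⟩

end CoveringCharacter

theorem Set.Finite.isUniformlyDiscrete {X : Type u} [uX : UniformSpace X] [T0Space X]
    {S : Set X} (hS : S.Finite) : IsUniformlyDiscrete uX S := by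
  have h : ∀ x y : X, ∃ r ∈ 𝓤 X, x ≠ y → (x, y) ∉ r := by
    intro x y
    by_cases hxy : x = y
    · exact ⟨univ, univ_mem, fun h ↦ absurd hxy h⟩
    · obtain ⟨r, hr, hr'⟩ := t0Space_iff_uniformity'.1 ‹_› hxy
      exact ⟨r, hr, fun _ ↦ hr'⟩
  choose r hr hr' using h
  refine ⟨⋂ x ∈ S, ⋂ y ∈ S, r x y,
    (biInter_mem hS).2 fun x _ ↦ (biInter_mem hS).2 fun y _ ↦ hr x y, fun x hx y hy hne hmem ↦ ?_⟩
  exact hr' x y hne (mem_iInter₂.1 (mem_iInter₂.1 hmem x hx) y hy)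

theorem not_completeSpace_rat : ¬ CompleteSpace ℚ := by
  intro h
  have hcl : IsClosed (range ((↑) : ℚ → ℝ)) :=
    Rat.isUniformEmbedding_coe_real.isUniformInducing.isComplete_range.isClosed
  have huniv : range ((↑) : ℚ → ℝ) = univ := by
    rw [← hcl.closure_eq, Rat.isDenseEmbedding_coe_real.dense.closure_range]
  exact irrational_sqrt_two (huniv ▸ mem_univ (√2))

namespace UnifClass

variable {C : UnifClass.{u}}

theorem ClosedUnderClosedSubspaces.bot_mem (hs : C.ClosedUnderClosedSubspaces)
    {X D : Type u} [uX : UniformSpace X] [T0Space X] (hX : C X uX)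
    {V : Set (X × X)} (hV : V ∈ 𝓤 X) {f : D → X} (hf : Pairwise fun x y ↦ (f x, f y) ∉ V) :
    C D ⊥ :=
  hs X D uX ⊥ hX ⟨f, isUniformEmbedding_of_spaced_out hV hf, isClosed_range_of_spaced_out hV hf⟩

theorem ClosedUnderClosedSubspaces.bot_mem_of_isUniformlyDiscrete
    (hs : C.ClosedUnderClosedSubspaces) {X : Type u} [uX : UniformSpace X] [T0Space X]
    (hX : C X uX) {S : Set X} (hS : IsUniformlyDiscrete uX S) : C S ⊥ := by
  obtain ⟨V, hV, h⟩ := hS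
  exact hs.bot_mem hX hV (f := Subtype.val)
    fun x y hxy ↦ h x x.2 y y.2 fun h ↦ hxy (Subtype.ext h)

/-- The discrete spaces in a class closed under closed subspaces are closed under injections. -/
theorem ClosedUnderClosedSubspaces.bot_mem_of_injective (hs : C.ClosedUnderClosedSubspaces)
    {X D : Type u} (hX : C X ⊥) {f : D → X} (hf : Function.Injective f) : C D ⊥ := by
  let _ : UniformSpace X := ⊥
  have := discreteTopology_bot X
  have hid : SetRel.id ∈ 𝓤 X := mem_principal_self _
  exact hs.bot_mem hX hid (f := f) fun x y hxy h ↦ hxy (hf h)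

theorem bot_mem_of_finite (hp : C.ClosedUnderProducts) (hs : C.ClosedUnderClosedSubspaces)
    {X : Type u} [uX : UniformSpace X] [T0Space X] [Nontrivial X] (hX : C X uX)
    (D : Type u) [Finite D] : C D ⊥ := by
  classical
  obtain ⟨x, y, hxy⟩ := exists_pair_ne X
  let f : D → (D → X) := fun d ↦ Function.update (fun _ ↦ x) d y
  have hf : Function.Injective f := by
    intro d e hde
    by_contra hne
    have := congrFun hde d
    simp [f, hne] at this
    exact hxy this.symm
  obtain ⟨V, hV, h⟩ := (finite_range f).isUniformlyDiscrete
  exact hs.bot_mem (hp D (fun _ ↦ X) (fun _ ↦ uX) fun _ ↦ hX) hV (f := f)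
    fun a b hab ↦ h _ (mem_range_self a) _ (mem_range_self b) (hf.ne hab)

/-- A uniformly continuous map on a subspace of a member, with values in a complete separated
space, extends to the closure of the subspace. -/
theorem mem_of_isUniformInducing (hs : C.ClosedUnderClosedSubspaces)
    (hd : C.ClosedUnderDenseImages) {X A Y : Type u} [uX : UniformSpace X] [uA : UniformSpace A]
    [uY : UniformSpace Y] [T0Space Y] [CompleteSpace Y] (hX : C X uX)
    {g : A → X} (hg : IsUniformInducing g) {f : A → Y} (hf : UniformContinuous f)
    (hfd : DenseRange f) : C Y uY := by
  let e : A → closure (range g) := fun a ↦ ⟨g a, subset_closure (mem_range_self a)⟩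
  have he : IsUniformInducing e := ((isUniformInducing_val _).of_comp_iff).1 hg
  have hed : DenseRange e := by
    intro x
    rw [IsInducing.subtypeVal.closure_eq_preimage_closure_image, ← range_comp]
    exact x.2
  have hcl : C (closure (range g)) inferInstance :=
    hs X _ uX _ hX ⟨Subtype.val, isUniformEmbedding_subtype_val, by simp⟩
  refine hd _ Y _ uY hcl ((isSeparatedUnif_iff_t0Space Y).2 inferInstance)
    ⟨_, uniformContinuous_uniformly_extend he hed hf, hfd.mono ?_⟩
  rintro _ ⟨a, rfl⟩
  exact ⟨e a, uniformly_extend_of_ind he hed hf a⟩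

/-- A complete separated space belongs to the class as soon as its uniformly discrete subsets,
regarded as discrete spaces, do. -/
theorem mem_of_completeSpace (hp : C.ClosedUnderProducts) (hs : C.ClosedUnderClosedSubspaces)
    (hd : C.ClosedUnderDenseImages) {Y : Type u} [uY : UniformSpace Y] [T0Space Y]
    [CompleteSpace Y] (h : ∀ S : Set Y, IsUniformlyDiscrete uY S → C S ⊥) : C Y uY := by
  choose S hS hcov using fun V : {V // V ∈ 𝓤 Y} ↦ exists_isUniformlyDiscrete_cover V.2
  choose r hr hrV using hcov
  let t : ∀ V, UniformSpace (S V) := fun _ ↦ ⊥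
  let g : Y → ∀ V, S V := fun y V ↦ ⟨r V y, hr V y⟩
  refine @mem_of_isUniformInducing C hs hd (∀ V, S V) Y Y (Pi.uniformSpace _)
    (UniformSpace.comap g (Pi.uniformSpace _)) uY _ _ (hp _ _ t fun V ↦ h _ (hS V)) g
    (@IsUniformInducing.mk _ _ (_) (_) _ rfl) id ?_ denseRange_id
  intro V hV
  obtain ⟨W, hW, hWs, hWV⟩ := comp_symm_mem_uniformity_sets hV
  have hproj : UniformContinuous fun p : ∀ V, S V ↦ p ⟨W, hW⟩ :=
    Pi.uniformContinuous_proj _ _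
  have hid : SetRel.id ∈ 𝓤 (S ⟨W, hW⟩) := mem_principal_self _
  refine mem_map.2 ⟨_, hproj hid, ?_⟩
  rintro ⟨x, y⟩ hxy
  have hxy' : r ⟨W, hW⟩ x = r ⟨W, hW⟩ y := congrArg Subtype.val hxy
  refine hWV ⟨r ⟨W, hW⟩ x, hrV ⟨W, hW⟩ x, ?_⟩
  rw [hxy']
  exact hWs.symm _ _ (hrV ⟨W, hW⟩ y)

/-- If the class has an incomplete member, then it contains every separated space whose
completion it contains. -/
theorem mem_of_completion_mem (hp : C.ClosedUnderProducts) (hs : C.ClosedUnderClosedSubspaces)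
    (hd : C.ClosedUnderDenseImages) {X Y : Type u} [uX : UniformSpace X] [uY : UniformSpace Y]
    [T0Space X] [T0Space Y] (hX : C X uX) (hinc : ¬ CompleteSpace X)
    (hY : C (Completion Y) inferInstance) : C Y uY := by
  obtain ⟨p, hpX⟩ : ∃ p : Completion X, p ∉ range ((↑) : X → Completion X) := by
    by_contra! hall
    exact hinc (((Completion.isUniformInducing_coe X).completeSpace_congr hall).2 inferInstance)
  let W : Set (Completion X × Completion Y) :=
    {q | q.1 ∈ range ((↑) : X → Completion X) ∨ q.2 ∈ range ((↑) : Y → Completion Y)}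
  let F : ULift.{u} Bool → Type u := fun b ↦ cond b.down X (Completion Y)
  let t : ∀ b, UniformSpace (F b) := fun b ↦ match b with
    | ⟨true⟩ => uX
    | ⟨false⟩ => (inferInstance : UniformSpace (Completion Y))
  have hF : C (∀ b, F b) (Pi.uniformSpace F) := hp _ F t fun b ↦ match b with
    | ⟨true⟩ => hX
    | ⟨false⟩ => hY
  let πX : (∀ b, F b) → X := fun q ↦ q ⟨true⟩
  let πY : (∀ b, F b) → Completion Y := fun q ↦ q ⟨false⟩
  have huX : UniformContinuous πX := Pi.uniformContinuous_proj F ⟨true⟩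
  have huY : UniformContinuous πY := Pi.uniformContinuous_proj F ⟨false⟩
  let m : (∀ b, F b) → W := fun q ↦
    ⟨((πX q : Completion X), πY q), Or.inl (mem_range_self _)⟩
  have hm : UniformContinuous m := UniformContinuous.subtype_mk
    (((Completion.uniformContinuous_coe X).comp huX).prodMk huY) _
  have hmd : DenseRange m := by
    intro w
    rw [IsInducing.subtypeVal.closure_eq_preimage_closure_image, ← range_comp]
    refine closure_mono ?_ ((Completion.denseRange_coe (α := X)).prodMap
      (denseRange_id (X := Completion Y)) w.1)
    rintro _ ⟨⟨x, y⟩, rfl⟩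
    exact ⟨fun b ↦ match b with
      | ⟨true⟩ => x
      | ⟨false⟩ => y, rfl⟩
  have hW : C W inferInstance :=
    hd _ W _ _ hF ((isSeparatedUnif_iff_t0Space W).2 inferInstance) ⟨m, hm, hmd⟩
  let f : Y → W := fun y ↦ ⟨(p, (y : Completion Y)), Or.inr (mem_range_self y)⟩
  have hf : UniformContinuous f := UniformContinuous.subtype_mk
    (uniformContinuous_const.prodMk (Completion.uniformContinuous_coe Y)) _
  have hfi : IsUniformEmbedding f := by
    refine IsUniformEmbedding.of_comp hf (g := fun w : W ↦ w.1.2)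
      (uniformContinuous_snd.comp uniformContinuous_subtype_val) ?_
    exact Completion.isUniformEmbedding_coe Y
  have hrange : range f = (fun w : W ↦ w.1.1) ⁻¹' {p} := by
    ext ⟨⟨a, b⟩, hab⟩
    constructor
    · rintro ⟨y, hy⟩
      exact (congrArg (fun w : W ↦ w.1.1) hy).symm
    · rintro rfl
      obtain ⟨y, rfl⟩ := hab.resolve_left hpX
      exact ⟨y, rfl⟩
  refine hs W Y _ uY hW ⟨f, hfi, ?_⟩
  rw [hrange]
  exact isClosed_singleton.preimage (continuous_fst.comp continuous_subtype_val)

theorem exists_not_completeSpace (hs : C.ClosedUnderClosedSubspaces)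
    (hd : C.ClosedUnderDenseImages) {X : Type u} [uX : UniformSpace X] [T0Space X]
    (hX : C X uX) (hnc : ¬ CompactSpace X) :
    ∃ (Z : Type u) (uZ : UniformSpace Z), C Z uZ ∧ ¬ @CompleteSpace Z uZ := by
  by_cases hc : CompleteSpace X
  swap
  · exact ⟨X, uX, hX, hc⟩
  have htb : ¬ CovCharLE X uX Cardinal.aleph0 := fun h ↦ hnc
    ⟨(totallyBounded_univ_iff_covCharLE.2 h).isCompact_of_isClosed isClosed_univ⟩
  simp only [CovCharLE, not_forall, not_lt] at htb
  obtain ⟨S, hS, hSinf⟩ := htb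
  have : Infinite S := Cardinal.infinite_iff.2 hSinf
  obtain ⟨f, hf⟩ : ∃ f : S → ULift.{u} ℚ, Function.Surjective f := by
    obtain ⟨i⟩ : Cardinal.mk (ULift.{u} ℚ) ≤ Cardinal.mk S :=
      Cardinal.mk_le_aleph0.trans hSinf
    exact ⟨Function.invFun i, Function.invFun_surjective i.injective⟩
  let _ : UniformSpace S := ⊥
  refine ⟨ULift.{u} ℚ, inferInstance, hd S _ ⊥ _ (hs.bot_mem_of_isUniformlyDiscrete hX hS)
    ((isSeparatedUnif_iff_t0Space _).2 inferInstance)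
    ⟨f, DiscreteUniformity.uniformContinuous S f, hf.denseRange⟩,
    fun h ↦ not_completeSpace_rat (completeSpace_ulift_iff.1 h)⟩

/-- A conjunction of separatedness with an invariant property inherits closure. -/
theorem closed_of_iff {P : UnifClass.{u}}
    (h : ∀ (X : Type u) (uX : UniformSpace X), C X uX ↔ (IsSeparatedUnif X uX ∧ P X uX))
    (hprod : P.ClosedUnderProducts) (hsub : P.ClosedUnderClosedSubspaces)
    (hdense : ∀ (X Y : Type u) [uX : UniformSpace X] [uY : UniformSpace Y] [T0Space Y] (f : X → Y),
      P X uX → UniformContinuous f → DenseRange f → P Y uY) :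
    C.ClosedUnderProducts ∧ C.ClosedUnderClosedSubspaces ∧ C.ClosedUnderDenseImages := by
  refine ⟨fun ι X t ht ↦ ?_, fun X Y uX uY hX hf ↦ ?_, ?_⟩
  · have := fun i ↦ (isSeparatedUnif_iff_t0Space (X i)).1 ((h _ _).1 (ht i)).1
    exact (h _ _).2 ⟨(isSeparatedUnif_iff_t0Space _).2 inferInstance,
      hprod ι X t fun i ↦ ((h _ _).1 (ht i)).2⟩
  · obtain ⟨hX, hPX⟩ := (h _ _).1 hX
    refine (h _ _).2 ⟨?_, hsub X Y uX uY hPX hf⟩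
    obtain ⟨f, hf, -⟩ := hf
    have := (isSeparatedUnif_iff_t0Space X).1 hX
    exact (isSeparatedUnif_iff_t0Space Y).2 hf.isEmbedding.t0Space
  · rintro X Y uX uY hX hY ⟨f, hf, hfd⟩
    have := (isSeparatedUnif_iff_t0Space Y).1 hY
    exact (h _ _).2 ⟨hY, hdense X Y f ((h _ _).1 hX).2 hf hfd⟩

end UnifClass

theorem epireflective_closed_under_epi_images_T2Unif
    (C : UnifClass.{u}) (hiso : C.IsoClosed)
    (hsep : ∀ (X : Type u) (uX : UniformSpace X), C X uX → IsSeparatedUnif X uX) :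
    (C.ClosedUnderProducts ∧ C.ClosedUnderClosedSubspaces ∧ C.ClosedUnderDenseImages) ↔
      ((∀ (X : Type u) (uX : UniformSpace X),
          C X uX ↔ (IsSeparatedUnif X uX ∧ Subsingleton X)) ∨
       (∀ (X : Type u) (uX : UniformSpace X),
          C X uX ↔ (IsSeparatedUnif X uX ∧ @CompactSpace X uX.toTopologicalSpace)) ∨
       (∃ lam : Cardinal.{u}, Cardinal.aleph0 ≤ lam ∧
         ∀ (X : Type u) (uX : UniformSpace X),
           C X uX ↔ (IsSeparatedUnif X uX ∧ CovCharLE X uX lam)) ∨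
       (∀ (X : Type u) (uX : UniformSpace X), C X uX ↔ IsSeparatedUnif X uX)) := by
  have hT0 : ∀ (X : Type u) [uX : UniformSpace X], C X uX → T0Space X :=
    fun X uX hX ↦ (isSeparatedUnif_iff_t0Space X).1 (hsep X uX hX)
  constructor
  · rintro ⟨hp, hs, hd⟩
    by_cases hsub : ∀ (X : Type u) (uX : UniformSpace X), C X uX → Subsingleton X
    · left
      refine fun X uX ↦ ⟨fun hX ↦ ⟨hsep X uX hX, hsub X uX hX⟩, fun ⟨hX, hX'⟩ ↦ ?_⟩
      let _ : UniformSpace PEmpty.{u + 1} := ⊥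
      have hpt := hp PEmpty.{u + 1} (fun _ ↦ PEmpty.{u + 1}) (fun _ ↦ ⊥) fun i ↦ i.elim
      have := hT0 _ hpt
      have hbot : C X ⊥ := hs.bot_mem hpt univ_mem (f := fun _ ↦ default)
        fun x y hxy ↦ absurd (Subsingleton.elim x y) hxy
      rwa [Subsingleton.elim uX ⊥]
    right
    push Not at hsub
    obtain ⟨X₂, u₂, hX₂, hnt⟩ := hsub
    have := hT0 X₂ hX₂
    have hfin : ∀ (D : Type u) [Finite D], C D ⊥ :=
      fun D _ ↦ UnifClass.bot_mem_of_finite hp hs hX₂ D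
    by_cases hcpt : ∀ (X : Type u) (uX : UniformSpace X), C X uX → CompactSpace X
    · left
      refine fun X uX ↦ ⟨fun hX ↦ ⟨hsep X uX hX, hcpt X uX hX⟩, fun ⟨hX, hX'⟩ ↦ ?_⟩
      have := (isSeparatedUnif_iff_t0Space X).1 hX
      refine UnifClass.mem_of_completeSpace hp hs hd fun S hS ↦ ?_
      have hSfin := totallyBounded_univ_iff_covCharLE.1
        (isCompact_univ (X := X)).totallyBounded S hS
      have := Cardinal.lt_aleph0_iff_finite.1 hSfin
      exact hfin S
    right
    push Not at hcpt
    obtain ⟨X, uX, hX, hXc⟩ := hcpt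
    have := hT0 X hX
    obtain ⟨Z, uZ, hZ, hZc⟩ := UnifClass.exists_not_completeSpace hs hd hX hXc
    have := hT0 Z hZ
    have key : ∀ (Y : Type u) [UniformSpace Y] [T0Space Y],
        (∀ S : Set (Completion Y), IsUniformlyDiscrete inferInstance S → C S ⊥) →
        C Y inferInstance := fun Y _ _ h ↦
      UnifClass.mem_of_completion_mem hp hs hd hZ hZc (UnifClass.mem_of_completeSpace hp hs hd h)
    by_cases hall : ∀ D : Type u, C D ⊥
    · right
      refine fun Y uY ↦ ⟨hsep Y uY, fun hY ↦ ?_⟩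
      have := (isSeparatedUnif_iff_t0Space Y).1 hY
      exact key Y fun S _ ↦ hall S
    left
    push Not at hall
    let B : Set Cardinal.{u} := {c | ∃ D : Type u, Cardinal.mk D = c ∧ ¬ C D ⊥}
    have hB : B.Nonempty := hall.imp' Cardinal.mk fun D hD ↦ ⟨D, rfl, hD⟩
    obtain ⟨D, hD, hDC⟩ := csInf_mem hB
    refine ⟨sInf B, ?_, fun Y uY ↦ ⟨fun hY ↦ ⟨hsep Y uY hY, fun S hS ↦ ?_⟩, fun ⟨hY, hYc⟩ ↦ ?_⟩⟩
    · rw [← hD, ← Cardinal.infinite_iff]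
      by_contra hnf
      have := not_infinite_iff_finite.1 hnf
      exact hDC (hfin D)
    · have := hT0 Y hY
      by_contra! hle
      rw [← hD] at hle
      obtain ⟨i⟩ := hle
      exact hDC (hs.bot_mem_of_injective (hs.bot_mem_of_isUniformlyDiscrete hY hS) i.injective)
    · have := (isSeparatedUnif_iff_t0Space Y).1 hY
      refine key Y fun S hS ↦ ?_
      by_contra hSC
      exact ((hYc.of_denseRange (Completion.uniformContinuous_coe Y)
        Completion.denseRange_coe) S hS).not_ge (csInf_le' ⟨S, rfl, hSC⟩)
  · rintro (h | h | ⟨c, hc, h⟩ | h)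
    · refine UnifClass.closed_of_iff (P := fun X _ ↦ Subsingleton X) h
        (fun ι X t ht ↦ inferInstance) ?_ ?_
      · rintro X Y uX uY hX ⟨f, hf, -⟩
        exact hf.injective.subsingleton
      · intro X Y _ _ _ f hX hf hfd
        have hcl : IsClosed (range f) := (subsingleton_range f).isClosed
        have : Function.Surjective f := by
          rw [← range_eq_univ, ← hcl.closure_eq, hfd.closure_range]
        exact this.subsingleton
    · refine UnifClass.closed_of_iff (P := fun X _ ↦ CompactSpace X) h
        (fun ι X t ht ↦ inferInstance) ?_ ?_
      · rintro X Y uX uY hX ⟨f, hf, hcl⟩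
        exact IsClosedEmbedding.compactSpace ⟨hf.isEmbedding, hcl⟩
      · intro X Y _ _ _ f hX hf hfd
        have hcl : IsClosed (range f) := (isCompact_range hf.continuous).isClosed
        have : Function.Surjective f := by
          rw [← range_eq_univ, ← hcl.closure_eq, hfd.closure_range]
        exact this.compactSpace hf.continuous
    · refine UnifClass.closed_of_iff (P := fun X uX ↦ CovCharLE X uX c) h
        (fun ι X t ht ↦ CovCharLE.pi hc ht) ?_ ?_
      · rintro X Y uX uY hX ⟨f, hf, -⟩
        exact hX.of_isUniformEmbedding hf
      · intro X Y _ _ _ f hX hf hfd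
        exact hX.of_denseRange hf hfd
    · refine UnifClass.closed_of_iff (P := fun _ _ ↦ True) (by simpa using h)
        (fun _ _ _ _ ↦ trivial) (fun _ _ _ _ _ _ ↦ trivial) fun _ _ _ _ _ _ _ _ _ ↦ trivial
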